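/- Run InfluenceMIS on a finite simple graph G on n vertices with initial undecided vertex set V_1^? = ∅ and an initial undecided edge set E_1^? of size b, where the permutation π is drawn uniformly at random from all permutations of the vertex set. Then for every i with 1 ≤ i < n/4, the expected number of undecided vertices at the beginning of iteration i satisfies E[|V_i^?|] ≤ 4bi/n. -/

import Mathlib

open Finset

/-- `lfmisAux W E π i` : the vertex at π-position `i` is in the greedy
lexicographically-first MIS of the graph with vertex set `W` and edge set `E`. -/
def lfmisAux {n : ℕ} (W : Set (Fin n)) (E : Set (Sym2 (Fin n))) (π : Equiv.Perm (Fin n))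
    (i : ℕ) : Prop :=
  (∃ h : i < n, π ⟨i, h⟩ ∈ W) ∧
    ∀ j, j < i →
      (∃ (h1 : j < n) (h2 : i < n), π ⟨j, h1⟩ ∈ W ∧ π ⟨i, h2⟩ ∈ W ∧
        s(π ⟨j, h1⟩, π ⟨i, h2⟩) ∈ E) → ¬ lfmisAux W E π j
termination_by i

/-- The lexicographically-first MIS of the graph with vertex set `W ⊆ Fin n`
and edge set `E`, under the permutation `π` (position `i` holds vertex `π i`). -/
def LFMISOn {n : ℕ} (W : Set (Fin n)) (E : Set (Sym2 (Fin n)))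
    (π : Equiv.Perm (Fin n)) : Set (Fin n) :=
  {v | v ∈ W ∧ lfmisAux W E π (π.symm v : ℕ)}

/-- State of the `InfluenceMIS` procedure: alive vertices, surviving edges,
undecided vertices, undecided edges. -/
structure MISState (n : ℕ) where
  verts : Finset (Fin n)
  edges : Finset (Sym2 (Fin n))
  uV : Finset (Fin n)
  uE : Finset (Sym2 (Fin n))

/-- Current neighbors of `u`. -/
def MISState.nbrs {n : ℕ} (st : MISState n) (u : Fin n) : Finset (Fin n) :=
  st.verts.filter fun v => v ≠ u ∧ s(u, v) ∈ st.edges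

/-- One iteration of `InfluenceMIS`, processing vertex `u`.  If `u` is not alive,
nothing happens.  If `u` is undecided, all of its neighbors become undecided and
`u` is deleted (it joins the influence set).  Otherwise `u` is (implicitly) added
to the MIS: its neighbors along undecided edges become undecided, its neighbors
along decided edges are deleted, and `u` is deleted. -/
def stepInf {n : ℕ} (st : MISState n) (u : Fin n) : MISState n :=
  if u ∉ st.verts then st
  else if u ∈ st.uV then
    { verts := st.verts.erase u
      edges := st.edges.filter fun e => u ∉ e
      uV := (st.uV ∪ st.nbrs u).erase u
      uE := st.uE.filter fun e => u ∉ e }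
  else
    let D := (st.nbrs u).filter fun v => s(u, v) ∉ st.uE
    let U := (st.nbrs u).filter fun v => s(u, v) ∈ st.uE
    { verts := (st.verts.erase u) \ D
      edges := st.edges.filter fun e => u ∉ e ∧ ∀ v ∈ D, v ∉ e
      uV := ((st.uV ∪ U) \ D).erase u
      uE := st.uE.filter fun e => u ∉ e ∧ ∀ v ∈ D, v ∉ e }

/-- `stateAt π st0 i` : the state at the beginning of (0-based) iteration `i`
of `InfluenceMIS` started from `st0`, where position `i` holds vertex `π i`
(so 1-based iteration `i` of the paper corresponds to `stateAt π st0 (i-1)`). -/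
def stateAt {n : ℕ} (π : Equiv.Perm (Fin n)) (st0 : MISState n) : ℕ → MISState n
  | 0 => st0
  | i + 1 => if h : i < n then stepInf (stateAt π st0 i) (π ⟨i, h⟩) else stateAt π st0 i

/-- The influence set returned by `InfluenceMIS`: vertices that are alive and
undecided at the beginning of their own iteration. -/
def influenceMIS {n : ℕ} (π : Equiv.Perm (Fin n)) (st0 : MISState n) : Finset (Fin n) :=
  Finset.univ.filter fun v =>
    v ∈ (stateAt π st0 (π.symm v : ℕ)).verts ∧ v ∈ (stateAt π st0 (π.symm v : ℕ)).uV

/-- Initial state of `InfluenceMIS` on a graph `G` with undecided vertices `uV`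
and undecided edges `uE`. -/
def initState {n : ℕ} (G : SimpleGraph (Fin n)) [DecidableRel G.Adj]
    (uV : Finset (Fin n)) (uE : Finset (Sym2 (Fin n))) : MISState n :=
  ⟨Finset.univ, G.edgeFinset, uV, uE⟩

/-- An upper bound for the change of the undecided status of `v` when `u` is processed. -/
def MISState.drift {n : ℕ} (st : MISState n) (u v : Fin n) : ℤ :=
  if u ∈ st.verts ∧ v ∈ st.verts ∧ v ≠ u ∧ s(u, v) ∈ st.edges then
    if u ∈ st.uV then (if v ∈ st.uV then 0 else 1)
    else if v ∈ st.uV then (if s(u, v) ∈ st.uE then 0 else -1)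
    else (if s(u, v) ∈ st.uE then 1 else 0)
  else 0

theorem stepInf_of_notMem {n : ℕ} {st : MISState n} {u : Fin n} (h : u ∉ st.verts) :
    stepInf st u = st := by
  simp [stepInf, h]

theorem indicator_stepInf_uV_sub_le_drift {n : ℕ} (st : MISState n) (u v : Fin n) :
    (if v ∈ (stepInf st u).uV then (1 : ℤ) else 0) - (if v ∈ st.uV then 1 else 0)
      ≤ st.drift u v := by
  by_cases hu : u ∈ st.verts
  · by_cases huV : u ∈ st.uV <;> by_cases hv : v ∈ st.verts <;> by_cases hvV : v ∈ st.uV <;>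
      by_cases hvu : v = u <;> by_cases he : s(u, v) ∈ st.edges <;>
      by_cases hue : s(u, v) ∈ st.uE <;>
      simp_all [stepInf, MISState.drift, MISState.nbrs]
  · simp [stepInf_of_notMem hu, MISState.drift, hu]

theorem drift_add_drift_swap_le {n : ℕ} (st : MISState n) (u v : Fin n) :
    st.drift u v + st.drift v u ≤ 2 * (if u ≠ v ∧ s(u, v) ∈ st.uE then 1 else 0) := by
  have hs : s(v, u) = s(u, v) := Sym2.eq_swap
  unfold MISState.drift
  rw [hs]
  by_cases hu : u ∈ st.verts <;> by_cases hv : v ∈ st.verts <;> by_cases huV : u ∈ st.uV <;>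
    by_cases hvV : v ∈ st.uV <;> by_cases hvu : u = v <;> by_cases he : s(u, v) ∈ st.edges <;>
    by_cases hue : s(u, v) ∈ st.uE <;> simp_all [eq_comm]

theorem card_filter_mk_mem_le {α : Type*} [Fintype α] [DecidableEq α] (E : Finset (Sym2 α)) :
    (univ.filter fun p : α × α => s(p.1, p.2) ∈ E).card ≤ 2 * E.card := by
  refine card_le_mul_card_image_of_maps_to (f := fun p : α × α => s(p.1, p.2))
    (fun p hp => (mem_filter.1 hp).2) 2 fun e _ => ?_
  induction e with
  | _ a b =>
    refine (card_le_card (t := {(a, b), (b, a)}) fun p hp => ?_).trans card_le_two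
    have h := (mem_filter.1 hp).2
    rcases Sym2.eq_iff.1 h with h | h <;> simp [Prod.ext_iff, h]

theorem sum_card_stepInf_uV_sub_le {n : ℕ} (st : MISState n) :
    ∑ u, (((stepInf st u).uV.card : ℤ) - st.uV.card) ≤ 2 * st.uE.card := by
  have hcard (s : Finset (Fin n)) : (s.card : ℤ) = ∑ v, if v ∈ s then 1 else 0 := by
    simp
  have hdrift : ∑ u, (((stepInf st u).uV.card : ℤ) - st.uV.card) ≤ ∑ u, ∑ v, st.drift u v := by
    refine sum_le_sum fun u _ => ?_
    rw [hcard, hcard, ← sum_sub_distrib]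
    exact sum_le_sum fun v _ => indicator_stepInf_uV_sub_le_drift st u v
  have hsymm : ∑ u, ∑ v, st.drift u v + ∑ u, ∑ v, st.drift u v ≤
      2 * ∑ u : Fin n, ∑ v : Fin n, if s(u, v) ∈ st.uE then (1 : ℤ) else 0 := by
    conv_lhs => enter [2]; rw [sum_comm]
    simp only [← sum_add_distrib, mul_sum]
    refine sum_le_sum fun u _ => sum_le_sum fun v _ => ?_
    refine (drift_add_drift_swap_le st u v).trans ?_
    split_ifs <;> simp_all
  have hpairs : ∑ u : Fin n, ∑ v : Fin n, (if s(u, v) ∈ st.uE then (1 : ℤ) else 0) ≤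
      2 * st.uE.card := by
    rw [← Fintype.sum_prod_type' (f := fun u v : Fin n => if s(u, v) ∈ st.uE then (1 : ℤ) else 0),
      sum_boole]
    exact_mod_cast card_filter_mk_mem_le st.uE
  linarith

theorem stepInf_uE_subset {n : ℕ} (st : MISState n) (u : Fin n) :
    (stepInf st u).uE ⊆ st.uE := by
  unfold stepInf
  split_ifs
  · exact filter_subset _ _
  · exact filter_subset _ _
  · exact Subset.rfl

theorem stepInf_verts_subset {n : ℕ} (st : MISState n) (u : Fin n) :
    (stepInf st u).verts ⊆ st.verts.erase u := by
  unfold stepInf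
  split_ifs with h
  · exact Subset.rfl
  · exact sdiff_subset
  · rw [erase_eq_of_notMem h]

theorem stateAt_uE_subset {n : ℕ} (π : Equiv.Perm (Fin n)) (st : MISState n) (k : ℕ) :
    (stateAt π st k).uE ⊆ st.uE := by
  induction k with
  | zero => exact Subset.rfl
  | succ k ih =>
    rw [stateAt]
    split_ifs
    · exact (stepInf_uE_subset _ _).trans ih
    · exact ih

theorem notMem_stateAt_verts {n : ℕ} (π : Equiv.Perm (Fin n)) (st : MISState n) (k : ℕ)
    (j : Fin n) (hj : (j : ℕ) < k) : π j ∉ (stateAt π st k).verts := by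
  induction k with
  | zero => omega
  | succ k ih =>
    rw [stateAt]
    split_ifs with hk
    · intro hmem
      obtain ⟨hne, hmem⟩ := mem_erase.1 (stepInf_verts_subset _ _ hmem)
      rcases Nat.lt_succ_iff_lt_or_eq.1 hj with h | rfl
      · exact ih h hmem
      · exact hne rfl
    · exact ih (by omega)

theorem stateAt_congr {n : ℕ} {π σ : Equiv.Perm (Fin n)} (st : MISState n) (k : ℕ)
    (h : ∀ j : Fin n, (j : ℕ) < k → π j = σ j) : stateAt π st k = stateAt σ st k := by
  induction k with
  | zero => rfl
  | succ k ih =>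
    rw [stateAt, stateAt, ih fun j hj => h j (by omega)]
    split_ifs with hk
    · rw [h ⟨k, hk⟩ (Nat.lt_succ_self k)]
    · rfl

/-- Conditionally on the first `k` processed vertices, the next one is uniformly distributed among
the remaining ones. -/
theorem sum_perm_stateAt_apply_eq {n : ℕ} (st : MISState n) (g : MISState n → Fin n → ℤ)
    (k j : Fin n) (hkj : k ≤ j) :
    ∑ π : Equiv.Perm (Fin n), g (stateAt π st k) (π j) =
      ∑ π : Equiv.Perm (Fin n), g (stateAt π st k) (π k) := by
  refine Fintype.sum_equiv (Equiv.mulRight (Equiv.swap k j)) _ _ fun π => ?_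
  have hst : stateAt (π * Equiv.swap k j) st k = stateAt π st k := by
    refine stateAt_congr st k fun i hi => ?_
    rw [Equiv.Perm.mul_apply, Equiv.swap_apply_of_ne_of_ne]
    · exact ne_of_lt hi
    · exact ne_of_lt (lt_of_lt_of_le hi hkj)
  simp [hst]

theorem sub_mul_sum_card_stateAt_uV_sub_le {n : ℕ} (st : MISState n) (k : Fin n) :
    ((n : ℤ) - k) * ∑ π : Equiv.Perm (Fin n),
        (((stateAt π st (k + 1)).uV.card : ℤ) - (stateAt π st k).uV.card)
      ≤ Fintype.card (Equiv.Perm (Fin n)) * (2 * st.uE.card) := by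
  let g : MISState n → Fin n → ℤ := fun s u => ((stepInf s u).uV.card : ℤ) - s.uV.card
  have hstep (π : Equiv.Perm (Fin n)) :
      ((stateAt π st (k + 1)).uV.card : ℤ) - (stateAt π st k).uV.card =
        g (stateAt π st k) (π k) := by
    simp [g, stateAt]
  have hremaining (π : Equiv.Perm (Fin n)) :
      ∑ j ∈ Ici k, g (stateAt π st k) (π j) = ∑ u, g (stateAt π st k) u := by
    rw [← Equiv.sum_comp π]
    refine sum_subset (subset_univ _) fun j _ hj => ?_
    have hlt : j < k := by simpa using hj
    simp [g, stepInf_of_notMem (notMem_stateAt_verts π st k j hlt)]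
  calc _ = ∑ j ∈ Ici k, ∑ π : Equiv.Perm (Fin n), g (stateAt π st k) (π j) := by
        rw [sum_congr rfl fun j hj => sum_perm_stateAt_apply_eq st g k j (mem_Ici.1 hj)]
        simp only [hstep, sum_const, Fin.card_Ici, nsmul_eq_mul]
        rw [Nat.cast_sub k.isLt.le]
    _ = ∑ π : Equiv.Perm (Fin n), ∑ u, g (stateAt π st k) u := by
        rw [sum_comm]
        exact sum_congr rfl fun π _ => hremaining π
    _ ≤ ∑ π : Equiv.Perm (Fin n), (2 * st.uE.card : ℤ) := by
        refine sum_le_sum fun π _ => (sum_card_stepInf_uV_sub_le _).trans ?_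
        have := card_le_card (stateAt_uE_subset π st k)
        omega
    _ = _ := by simp

theorem sum_card_stateAt_uV_le {n : ℕ} (st : MISState n) (hst : st.uV = ∅) (k : ℕ)
    (hk : 2 * k ≤ n) :
    (∑ π : Equiv.Perm (Fin n), ((stateAt π st k).uV.card : ℝ)) ≤
      Fintype.card (Equiv.Perm (Fin n)) * (4 * st.uE.card * k / n) := by
  induction k with
  | zero => simp [stateAt, hst]
  | succ k ih =>
    have hkn : k < n := by omega
    have hstep := sub_mul_sum_card_stateAt_uV_sub_le st ⟨k, hkn⟩
    have hstep' : ((n : ℝ) - k) * ∑ π : Equiv.Perm (Fin n),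
        (((stateAt π st (k + 1)).uV.card : ℝ) - (stateAt π st k).uV.card)
          ≤ Fintype.card (Equiv.Perm (Fin n)) * (2 * st.uE.card) := by
      exact_mod_cast hstep
    have hn : (0 : ℝ) < n := by exact_mod_cast (by omega : 0 < n)
    have hhalf : 2 * ((k : ℝ) + 1) ≤ n := by exact_mod_cast hk
    rw [sum_sub_distrib, mul_comm, ← le_div_iff₀ (by linarith)] at hstep'
    have hquot : (Fintype.card (Equiv.Perm (Fin n)) : ℝ) * (2 * st.uE.card) / (n - k) ≤
        Fintype.card (Equiv.Perm (Fin n)) * (4 * st.uE.card / n) := by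
      have hnonneg : (0 : ℝ) ≤ Fintype.card (Equiv.Perm (Fin n)) * (2 * st.uE.card) := by
        positivity
      calc _ ≤ (Fintype.card (Equiv.Perm (Fin n)) : ℝ) * (2 * st.uE.card) / (n / 2) :=
            div_le_div_of_nonneg_left hnonneg (by linarith) (by linarith)
        _ = _ := by field_simp; ring
    have hsplit : (Fintype.card (Equiv.Perm (Fin n)) : ℝ) *
          (4 * st.uE.card * ((k + 1 : ℕ) : ℝ) / n) =
        Fintype.card (Equiv.Perm (Fin n)) * (4 * st.uE.card * k / n) +
          Fintype.card (Equiv.Perm (Fin n)) * (4 * st.uE.card / n) := by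
      push_cast
      ring
    linarith [ih (by omega)]

/-- Run `InfluenceMIS` with `V₁? = ∅` and `|E₁?| = b` over a uniformly random
permutation.  For every iteration `i` (1-based) with `1 ≤ i < n/4`, the expected
number of undecided vertices at the beginning of iteration `i` is at most
`4·b·i/n` (stated as: the sum over all permutations is at most `n! · 4bi/n`). -/
theorem expected_undecided_vertices_le {n : ℕ} (G : SimpleGraph (Fin n))
    [DecidableRel G.Adj] (uE : Finset (Sym2 (Fin n))) (huE : uE ⊆ G.edgeFinset)
    (b : ℕ) (hb : uE.card = b)
    (i : ℕ) (h1 : 1 ≤ i) (h2 : (i : ℝ) < (n : ℝ) / 4) :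
    (∑ π : Equiv.Perm (Fin n), ((stateAt π (initState G ∅ uE) (i - 1)).uV.card : ℝ))
      ≤ (Fintype.card (Equiv.Perm (Fin n)) : ℝ) * (4 * (b : ℝ) * (i : ℝ) / (n : ℝ)) := by
  have hi : 4 * i ≤ n := by
    have : (4 * i : ℝ) ≤ n := by linarith
    exact_mod_cast this
  have hle : ((i - 1 : ℕ) : ℝ) ≤ i := by exact_mod_cast Nat.sub_le i 1
  refine (sum_card_stateAt_uV_le (initState G ∅ uE) rfl (i - 1) (by omega)).trans ?_
  have hcard : (initState G ∅ uE).uE.card = b := hb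
  rw [hcard]
  gcongr
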